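/- Let χ_1,…,χ_N and φ_1,…,φ_N be orthonormal families in L²(ℝ³) with span{χ_1,…,χ_N} = span{φ_1,…,φ_N}. Then: (i) Q^{χ_j} Q^{χ_k} = Q^{χ_k} Q^{χ_j} as bounded operators on L²(ℝ^{3N}; H) for all j, k ∈ {1,…,N}; (ii) Σ_{j=1}^N Q^{χ_j} = Σ_{m=1}^N q_m as operators on L²(ℝ^{3N}; H), where q_m is built from φ_1,…,φ_N; (iii) for every fully antisymmetric Ψ ∈ L²(ℝ^{3N}; H) and every j, (P^{χ_j})² Ψ = P^{χ_j} Ψ and (Q^{χ_j})² Ψ = Q^{χ_j} Ψ. -/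

import Mathlib

open MeasureTheory

noncomputable section

abbrev E3 : Type := EuclideanSpace ℝ (Fin 3)

abbrev OneL2 : Type := Lp ℂ 2 (volume : Measure E3)

abbrev NL2 (H : Type) [NormedAddCommGroup H] [InnerProductSpace ℂ H] (N : ℕ) : Type :=
  Lp H 2 (volume : Measure (Fin N → E3))

variable {H : Type} [NormedAddCommGroup H] [InnerProductSpace ℂ H] [CompleteSpace H]

/-- `T` acts as the rank-one operator `(|χ'⟩⟨χ|)` in the `m`-th variable. -/
def IsRankOneAt {N : ℕ} (χ' χ : OneL2) (m : Fin N)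
    (T : NL2 H N →L[ℂ] NL2 H N) : Prop :=
  ∀ Ψ : NL2 H N, (T Ψ : (Fin N → E3) → H) =ᵐ[volume]
    fun x => (χ' : E3 → ℂ) (x m) •
      ∫ y : E3, (starRingEnd ℂ) ((χ : E3 → ℂ) y) • (Ψ : (Fin N → E3) → H) (Function.update x m y)

/-- `Ψ` is antisymmetric in the variables with indices in `S`. -/
def AntisymmetricOn {N : ℕ} (S : Finset (Fin N)) (Ψ : NL2 H N) : Prop :=
  ∀ σ : Equiv.Perm (Fin N), (∀ i ∉ S, σ i = i) →
    (fun x : Fin N → E3 => (Ψ : (Fin N → E3) → H) (x ∘ σ)) =ᵐ[volume]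
      fun x => (((Equiv.Perm.sign σ : ℤ) : ℂ)) • (Ψ : (Fin N → E3) → H) x


open Filter Topology
open scoped ENNReal

/-- The measure of the difference between the members of an increasing sequence and their union
tends to zero when the union has finite measure. -/
theorem tendsto_measure_symmDiff_iUnion {α : Type*} [MeasurableSpace α] {μ : Measure α}
    {t : ℕ → Set α} {s : Set α} (ht : ∀ n, MeasurableSet (t n)) (hmono : Monotone t)
    (hs : ⋃ n, t n = s) (hμs : μ s ≠ ∞) :
    Tendsto (fun n => μ (symmDiff (t n) s)) atTop (𝓝 0) := by
  have hsub : ∀ n, symmDiff (t n) s = s \ t n := fun n =>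
    symmDiff_of_le (hs ▸ Set.subset_iUnion t n)
  have hsm : MeasurableSet s := hs ▸ MeasurableSet.iUnion ht
  have hempty : ⋂ n, s \ t n = ∅ := by
    rw [← Set.sdiff_iUnion, hs, Set.sdiff_self]
  have h := tendsto_measure_iInter_atTop (μ := μ) (s := fun n => s \ t n)
    (fun n => (hsm.diff (ht n)).nullMeasurableSet)
    (fun _ _ hmn => Set.sdiff_subset_sdiff_right (hmono hmn))
    ⟨0, measure_ne_top_of_subset Set.sdiff_subset hμs⟩
  rw [hempty, measure_empty] at h
  simpa only [hsub, Function.comp_def] using h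

section Density

variable {α E : Type*} [MeasurableSpace α] {μ : Measure α} [NormedAddCommGroup E]
  [NormedSpace ℂ E] {p : ℝ≥0∞} [Fact (1 ≤ p)]

/-- Dynkin's argument in `Lp`: if a closed subspace contains the indicators of `s ∩ K` for `s` in
a generating `π`-system and for `s = univ`, then it does so for every measurable `s`. -/
theorem indicatorConstLp_inter_mem_of_isPiSystem (hp : p ≠ ∞) {V : Submodule ℂ (Lp E p μ)}
    (hV : IsClosed (V : Set (Lp E p μ))) {C : Set (Set α)}
    (hgen : ‹MeasurableSpace α› = MeasurableSpace.generateFrom C) (hC : IsPiSystem C)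
    {K : Set α} (hK : MeasurableSet K) (hμK : μ K ≠ ∞) (c : E)
    (huniv : indicatorConstLp p hK hμK c ∈ V)
    (hmem : ∀ s ∈ C, ∀ hs : MeasurableSet (s ∩ K),
      indicatorConstLp p hs (measure_ne_top_of_subset Set.inter_subset_right hμK) c ∈ V)
    {s : Set α} (hs : MeasurableSet s) :
    indicatorConstLp p (hs.inter hK) (measure_ne_top_of_subset Set.inter_subset_right hμK) c
      ∈ V := by
  have hfin : ∀ t : Set α, μ (t ∩ K) ≠ ∞ := fun t =>
    measure_ne_top_of_subset Set.inter_subset_right hμK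
  induction s, hs using MeasurableSpace.induction_on_inter hgen hC with
  | empty => simp
  | basic t ht => exact hmem t ht _
  | compl t ht ih =>
    have h := indicatorConstLp_disjoint_union (p := p) (ht.inter hK) (ht.compl.inter hK)
      (hfin t) (hfin tᶜ)
      (Disjoint.mono Set.inter_subset_left Set.inter_subset_left disjoint_compl_right) c
    have hKeq : t ∩ K ∪ tᶜ ∩ K = K := by
      rw [← Set.union_inter_distrib_right, Set.union_compl_self, Set.univ_inter]
    simp only [hKeq] at h
    rw [eq_sub_of_add_eq' h.symm]
    exact V.sub_mem huniv ih
  | iUnion f hd hf ih =>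
    have hacc : ∀ n, MeasurableSet (Set.accumulate f n) := fun n =>
      MeasurableSet.biUnion (Set.to_countable _) fun i _ => hf i
    have hpart : ∀ n, indicatorConstLp p ((hacc n).inter hK) (hfin _) c ∈ V := by
      intro n
      induction n with
      | zero => simpa [Set.accumulate] using ih 0
      | succ n ihn =>
        have hdisj : Disjoint (Set.accumulate f n) (f (n + 1)) :=
          Set.disjoint_accumulate hd (Nat.lt_succ_self n)
        have h := indicatorConstLp_disjoint_union (p := p) ((hacc n).inter hK)
          ((hf (n + 1)).inter hK) (hfin _) (hfin _)
          (Disjoint.mono Set.inter_subset_left Set.inter_subset_left hdisj) c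
        simp only [← Set.union_inter_distrib_right, ← Set.accumulate_succ] at h
        rw [h]
        exact V.add_mem ihn (ih _)
    refine hV.mem_of_tendsto (tendsto_indicatorConstLp_set hp
      (tendsto_measure_symmDiff_iUnion (fun n => (hacc n).inter hK)
        (fun _ _ hmn => Set.inter_subset_inter_left K (Set.monotone_accumulate hmn)) ?_
        (hfin _))) (Eventually.of_forall hpart)
    rw [← Set.iUnion_inter, Set.iUnion_accumulate]

end Density

/-- The box `∏ᵢ closedBall 0 n`. -/
def centeredBox (N n : ℕ) : Set (Fin N → E3) :=
  Set.univ.pi fun _ => Metric.closedBall 0 n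

theorem measurableSet_centeredBox (N n : ℕ) : MeasurableSet (centeredBox N n) :=
  MeasurableSet.univ_pi fun _ => measurableSet_closedBall

theorem volume_centeredBox_ne_top (N n : ℕ) : volume (centeredBox N n) ≠ ∞ := by
  rw [centeredBox, volume_pi_pi]
  exact ENNReal.prod_ne_top fun _ _ => measure_closedBall_lt_top.ne

theorem monotone_centeredBox (N : ℕ) : Monotone (centeredBox N) := fun _ _ h =>
  Set.pi_mono fun _ _ => Metric.closedBall_subset_closedBall (by exact_mod_cast h)

theorem iUnion_centeredBox (N : ℕ) : ⋃ n, centeredBox N n = Set.univ := by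
  refine Set.eq_univ_of_forall fun x => ?_
  obtain ⟨n, hn⟩ := exists_nat_ge ‖x‖
  refine Set.mem_iUnion.2 ⟨n, fun i _ => ?_⟩
  simpa using (norm_le_pi_norm x i).trans hn

section ProductVectors

variable {H : Type} [NormedAddCommGroup H] [InnerProductSpace ℂ H] {N : ℕ}

/-- A property of one variable that holds almost everywhere also holds almost everywhere in the
`i`-th variable. -/
theorem ae_eval_of_ae {p : E3 → Prop} (hp : ∀ᵐ y : E3, p y) (i : Fin N) :
    ∀ᵐ x : Fin N → E3, p (x i) :=
  (Measure.quasiMeasurePreserving_eval (fun _ : Fin N => (volume : Measure E3)) i).ae hp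

theorem memLp_prodFun (f : Fin N → OneL2) (h : H) :
    MemLp (fun x : Fin N → E3 => (∏ i, (f i : E3 → ℂ) (x i)) • h) 2 volume := by
  have hmeas : AEStronglyMeasurable (fun x : Fin N → E3 => ∏ i, (f i : E3 → ℂ) (x i)) volume :=
    Finset.aestronglyMeasurable_fun_prod _ fun i _ =>
      (Lp.aestronglyMeasurable (f i)).comp_quasiMeasurePreserving
        (Measure.quasiMeasurePreserving_eval (fun _ : Fin N => (volume : Measure E3)) i)
  rw [memLp_two_iff_integrable_sq_norm (hmeas.smul_const h)]
  simp only [norm_smul, norm_prod, mul_pow, ← Finset.prod_pow]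
  exact (Integrable.fintype_prod fun i =>
    (memLp_two_iff_integrable_sq_norm (Lp.aestronglyMeasurable (f i))).1
      (Lp.memLp (f i))).mul_const _

/-- The product of one-body functions, with one of the factors singled out. -/
theorem prod_update_apply [DecidableEq (Fin N)] (f : Fin N → OneL2) (m : Fin N) (g : OneL2)
    (x : Fin N → E3) :
    ∏ i, (Function.update f m g i : E3 → ℂ) (x i)
      = (g : E3 → ℂ) (x m) * ∏ i ∈ Finset.univ \ {m}, (f i : E3 → ℂ) (x i) := by
  rw [← Finset.prod_update_of_mem (Finset.mem_univ m)]
  exact Finset.prod_congr rfl fun i _ =>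
    Function.apply_update (fun i (u : OneL2) => (u : E3 → ℂ) (x i)) f m g i

/-- The product vector `f₁ ⊗ ⋯ ⊗ f_N ⊗ h`, as a multilinear map of the `fᵢ`. -/
def prodVec (h : H) : MultilinearMap ℂ (fun _ : Fin N => OneL2) (NL2 H N) where
  toFun f := (memLp_prodFun f h).toLp _
  map_update_add' f m u v := by
    refine Lp.ext ?_
    filter_upwards [(memLp_prodFun (Function.update f m (u + v)) h).coeFn_toLp,
      (memLp_prodFun (Function.update f m u) h).coeFn_toLp,
      (memLp_prodFun (Function.update f m v) h).coeFn_toLp,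
      Lp.coeFn_add ((memLp_prodFun (Function.update f m u) h).toLp _)
        ((memLp_prodFun (Function.update f m v) h).toLp _),
      ae_eval_of_ae (Lp.coeFn_add u v) m] with x h1 h2 h3 h4 h5
    rw [h1, h4, Pi.add_apply, h2, h3]
    simp only [prod_update_apply, h5, Pi.add_apply, add_mul, add_smul]
  map_update_smul' f m c u := by
    refine Lp.ext ?_
    filter_upwards [(memLp_prodFun (Function.update f m (c • u)) h).coeFn_toLp,
      (memLp_prodFun (Function.update f m u) h).coeFn_toLp,
      Lp.coeFn_smul c ((memLp_prodFun (Function.update f m u) h).toLp _),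
      ae_eval_of_ae (Lp.coeFn_smul c u) m] with x h1 h2 h3 h4
    rw [h1, h3, Pi.smul_apply, h2]
    simp only [prod_update_apply, h4, Pi.smul_apply, smul_eq_mul, mul_smul]

theorem coeFn_prodVec (h : H) (f : Fin N → OneL2) :
    (prodVec h f : (Fin N → E3) → H) =ᵐ[volume] fun x => (∏ i, (f i : E3 → ℂ) (x i)) • h :=
  (memLp_prodFun f h).coeFn_toLp

/-- Indicators of boxes are product vectors. -/
theorem indicatorConstLp_pi_eq_prodVec {t : Fin N → Set E3} (ht : ∀ i, MeasurableSet (t i))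
    (hμt : ∀ i, volume (t i) ≠ ∞) (hs : MeasurableSet (Set.univ.pi t))
    (hμs : volume (Set.univ.pi t) ≠ ∞) (h : H) :
    indicatorConstLp 2 hs hμs h = prodVec h fun i => indicatorConstLp 2 (ht i) (hμt i) (1 : ℂ) := by
  refine Lp.ext ?_
  have hae : ∀ᵐ x : Fin N → E3, ∀ i,
      (indicatorConstLp 2 (ht i) (hμt i) (1 : ℂ) : E3 → ℂ) (x i)
        = (t i).indicator (fun _ => (1 : ℂ)) (x i) :=
    ae_all_iff.2 fun i => ae_eval_of_ae indicatorConstLp_coeFn i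
  filter_upwards [indicatorConstLp_coeFn (p := 2) (hs := hs) (hμs := hμs) (c := h),
    coeFn_prodVec h fun i => indicatorConstLp 2 (ht i) (hμt i) (1 : ℂ), hae] with x h1 h2 h3
  rw [h1, h2]
  simp only [h3]
  by_cases hx : x ∈ Set.univ.pi t
  · rw [Set.indicator_of_mem hx, Finset.prod_eq_one, one_smul]
    exact fun i _ => Set.indicator_of_mem (hx i trivial) _
  · rw [Set.indicator_of_notMem hx]
    obtain ⟨i, hi⟩ : ∃ i, x i ∉ t i := by simpa [Set.mem_pi] using hx
    rw [Finset.prod_eq_zero (Finset.mem_univ i) (Set.indicator_of_notMem hi _), zero_smul]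

/-- A closed subspace containing all product vectors is the whole space. -/
theorem mem_of_prodVec_mem {V : Submodule ℂ (NL2 H N)} (hV : IsClosed (V : Set (NL2 H N)))
    (hprod : ∀ (h : H) (f : Fin N → OneL2), prodVec h f ∈ V) (Ψ : NL2 H N) : Ψ ∈ V := by
  have hbox : ∀ (h : H) (t : Fin N → Set E3), (∀ i, MeasurableSet (t i)) →
      (∀ i, volume (t i) ≠ ∞) → ∀ (hs : MeasurableSet (Set.univ.pi t))
      (hμs : volume (Set.univ.pi t) ≠ ∞), indicatorConstLp 2 hs hμs h ∈ V := by
    intro h t ht hμt hs hμs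
    rw [indicatorConstLp_pi_eq_prodVec ht hμt]
    exact hprod _ _
  induction Ψ using Lp.induction (p := 2) ENNReal.ofNat_ne_top with
  | indicatorConst h hs hμs =>
    rename_i s
    rw [Lp.simpleFunc.coe_indicatorConst]
    refine hV.mem_of_tendsto (tendsto_indicatorConstLp_set ENNReal.ofNat_ne_top
      (t := fun n => s ∩ centeredBox N n)
      (ht := fun n => hs.inter (measurableSet_centeredBox N n))
      (hμt := fun n => measure_ne_top_of_subset Set.inter_subset_left hμs.ne)
      (tendsto_measure_symmDiff_iUnion (fun n => hs.inter (measurableSet_centeredBox N n))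
        (fun _ _ hmn => Set.inter_subset_inter_right s (monotone_centeredBox N hmn)) ?_ hμs.ne))
      (Eventually.of_forall fun n => ?_)
    · rw [← Set.inter_iUnion, iUnion_centeredBox, Set.inter_univ]
    · refine indicatorConstLp_inter_mem_of_isPiSystem ENNReal.ofNat_ne_top hV
        generateFrom_pi.symm isPiSystem_pi (measurableSet_centeredBox N n)
        (volume_centeredBox_ne_top N n) h ?_ ?_ hs
      · exact hbox h _ (fun _ => measurableSet_closedBall)
          (fun _ => measure_closedBall_lt_top.ne) _ _
      · rintro _ ⟨t, ht, rfl⟩ hm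
        have heq : Set.univ.pi t ∩ centeredBox N n
            = Set.univ.pi fun i => t i ∩ Metric.closedBall 0 n := Set.pi_inter_distrib.symm
        simp only [heq] at hm ⊢
        exact hbox h _ (fun i => MeasurableSet.inter
            (show MeasurableSet (t i) from ht i trivial) measurableSet_closedBall)
          (fun _ => measure_ne_top_of_subset Set.inter_subset_right
            measure_closedBall_lt_top.ne) _ _
  | add hf hg _ ihf ihg => exact V.add_mem ihf ihg
  | isClosed => exact hV

/-- Bounded operators that agree on product vectors are equal. -/
theorem ContinuousLinearMap.ext_prodVec {S T : NL2 H N →L[ℂ] NL2 H N}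
    (hST : ∀ (h : H) (f : Fin N → OneL2), S (prodVec h f) = T (prodVec h f)) : S = T := by
  ext1 Ψ
  have hmem := mem_of_prodVec_mem (V := (S - T).ker) (S - T).isClosed_ker
    (fun h f => by simp [hST h f]) Ψ
  exact sub_eq_zero.1 (by simpa using hmem)

/-- Almost every section along the `m`-th variable of a conull set is conull. -/
theorem ae_ae_update_of_ae {p : (Fin N → E3) → Prop} (hp : ∀ᵐ x, p x) (m : Fin N) :
    ∀ᵐ x : Fin N → E3, ∀ᵐ y : E3, p (Function.update x m y) := by
  obtain ⟨s, hsub, hs, hs0⟩ := exists_measurable_superset_of_null (ae_iff.1 hp)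
  set F : (Fin N → E3) → ℝ≥0∞ := s.indicator 1 with hF
  have hFm : Measurable F := measurable_one.indicator hs
  have hF0 : ∫⁻ x, F x = 0 := by rw [hF, lintegral_indicator_one hs, hs0]
  set G : (Fin N → E3) → ℝ≥0∞ := fun x => ∫⁻ y, F (Function.update x m y) with hG
  have hGeq : (∫⋯∫⁻_{m}, F ∂fun _ => (volume : Measure E3)) = G := lmarginal_singleton _ _
  have hGm : Measurable G := hGeq ▸ hFm.lmarginal _
  have hG0 : ∫⁻ x, G x = 0 := by
    have hout : lmarginal (fun _ => (volume : Measure E3)) (Finset.univ.erase m) G = 0 := by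
      rw [hG, ← lmarginal_erase' F hFm (Finset.mem_univ m),
        lmarginal_univ]
      exact funext fun _ => hF0
    rcases isEmpty_or_nonempty (Fin N → E3) with hemp | ⟨⟨x₀⟩⟩
    · exact lintegral_of_isEmpty _ _
    · rw [volume_pi, lintegral_eq_lmarginal_univ x₀,
        lmarginal_erase G hGm (Finset.mem_univ m), hout]
      simp
  filter_upwards [(lintegral_eq_zero_iff hGm).1 hG0] with x hx
  have hFx : (fun y => F (Function.update x m y)) =ᵐ[volume] 0 :=
    (lintegral_eq_zero_iff (hFm.comp (measurable_update x))).1 hx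
  filter_upwards [hFx] with y hy
  by_contra hcon
  have : Function.update x m y ∈ s := hsub hcon
  simp [hF, this] at hy

theorem measurePreserving_comp_perm (σ : Equiv.Perm (Fin N)) :
    MeasurePreserving (fun x : Fin N → E3 => x ∘ σ) volume volume :=
  (volume_preserving_arrowCongr' σ.symm (MeasurableEquiv.refl E3) (.id _))

/-- Permuting the variables of a product vector permutes its factors. -/
theorem compMeasurePreserving_perm_prodVec (σ : Equiv.Perm (Fin N)) (h : H)
    (f : Fin N → OneL2) :
    Lp.compMeasurePreserving _ (measurePreserving_comp_perm σ) (prodVec h f)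
      = prodVec h (f ∘ σ.symm) := by
  refine Lp.ext ?_
  filter_upwards [Lp.coeFn_compMeasurePreserving (prodVec h f) (measurePreserving_comp_perm σ),
    (measurePreserving_comp_perm σ).quasiMeasurePreserving.ae (coeFn_prodVec h f),
    coeFn_prodVec h (f ∘ σ.symm)] with x h1 h2 h3
  rw [h1, Function.comp_apply, h2, h3,
    ← Equiv.prod_comp σ fun i => ((f ∘ σ.symm) i : E3 → ℂ) (x i)]
  simp

variable [CompleteSpace H]

/-- Rank-one operators in the `m`-th variable map product vectors to product vectors. -/
theorem IsRankOneAt.apply_prodVec {a b : OneL2} {m : Fin N} {T : NL2 H N →L[ℂ] NL2 H N}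
    (hT : IsRankOneAt a b m T) (h : H) (f : Fin N → OneL2) :
    T (prodVec h f) = inner ℂ b (f m) • prodVec h (Function.update f m a) := by
  refine Lp.ext ?_
  filter_upwards [hT (prodVec h f), ae_ae_update_of_ae (coeFn_prodVec h f) m,
    Lp.coeFn_smul (inner ℂ b (f m)) (prodVec h (Function.update f m a)),
    coeFn_prodVec h (Function.update f m a)] with x h1 h2 h3 h4
  rw [h1, h3, Pi.smul_apply, h4, prod_update_apply, L2.inner_def]
  set r : ℂ := ∏ i ∈ Finset.univ \ {m}, (f i : E3 → ℂ) (x i)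
  have hprod : ∀ y : E3, ∏ i, (f i : E3 → ℂ) (Function.update x m y i)
      = (f m : E3 → ℂ) y * r := by
    intro y
    rw [← Finset.prod_update_of_mem (Finset.mem_univ m)]
    exact Finset.prod_congr rfl fun i _ =>
      Function.apply_update (fun i (z : E3) => (f i : E3 → ℂ) z) x m y i
  have hint : ∫ y : E3, (starRingEnd ℂ) ((b : E3 → ℂ) y) •
      (prodVec h f : (Fin N → E3) → H) (Function.update x m y)
        = ∫ y : E3, inner ℂ ((b : E3 → ℂ) y) ((f m : E3 → ℂ) y) • (r • h) := by
    refine integral_congr_ae ?_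
    filter_upwards [h2] with y hy
    rw [hy, hprod, RCLike.inner_apply, smul_smul, smul_smul]
    ring_nf
  rw [hint, integral_smul_const, smul_smul, smul_smul, smul_smul]
  ring_nf

theorem IsRankOneAt.comp_prodVec {a b c d : OneL2} {m n : Fin N} {S T : NL2 H N →L[ℂ] NL2 H N}
    (hS : IsRankOneAt a b m S) (hT : IsRankOneAt c d n T) (hmn : m ≠ n) (h : H)
    (f : Fin N → OneL2) :
    S (T (prodVec h f)) = (inner ℂ b (f m) * inner ℂ d (f n)) •
      prodVec h (Function.update (Function.update f n c) m a) := by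
  rw [hT.apply_prodVec, map_smul, hS.apply_prodVec, Function.update_of_ne hmn, smul_smul, mul_comm]

/-- Operators acting in different variables commute. -/
theorem IsRankOneAt.commute_of_ne {a b c d : OneL2} {m n : Fin N}
    {S T : NL2 H N →L[ℂ] NL2 H N} (hS : IsRankOneAt a b m S) (hT : IsRankOneAt c d n T)
    (hmn : m ≠ n) : Commute S T := by
  refine ContinuousLinearMap.ext_prodVec fun h f => ?_
  rw [mul_apply_eq_comp, mul_apply_eq_comp, hS.comp_prodVec hT hmn,
    hT.comp_prodVec hS hmn.symm, mul_comm, Function.update_comm hmn]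

theorem IsRankOneAt.mul_eq_zero_of_inner_eq_zero {a b : OneL2} {m : Fin N}
    {S T : NL2 H N →L[ℂ] NL2 H N} (hS : IsRankOneAt a a m S) (hT : IsRankOneAt b b m T)
    (h : inner ℂ a b = (0 : ℂ)) :
    S * T = 0 := by
  refine ContinuousLinearMap.ext_prodVec fun v f => ?_
  rw [mul_apply_eq_comp, hT.apply_prodVec, map_smul, hS.apply_prodVec,
    Function.update_self, h, zero_smul, smul_zero, zero_apply]

theorem IsRankOneAt.isIdempotentElem {a : OneL2} {m : Fin N} {S : NL2 H N →L[ℂ] NL2 H N}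
    (hS : IsRankOneAt a a m S) (ha : ‖a‖ = 1) : IsIdempotentElem S := by
  refine ContinuousLinearMap.ext_prodVec fun v f => ?_
  rw [mul_apply_eq_comp, hS.apply_prodVec, map_smul, hS.apply_prodVec,
    Function.update_self, inner_self_eq_norm_sq_to_K, ha, Function.update_idem]
  simp

/-- The same rank-one projection in two different variables annihilates antisymmetric vectors. -/
theorem AntisymmetricOn.apply_apply_eq_zero {a : OneL2} {m n : Fin N}
    {S T : NL2 H N →L[ℂ] NL2 H N} (hS : IsRankOneAt a a m S) (hT : IsRankOneAt a a n T)
    (hmn : m ≠ n) {Ψ : NL2 H N} (hΨ : AntisymmetricOn Finset.univ Ψ) : S (T Ψ) = 0 := by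
  set σ : Equiv.Perm (Fin N) := Equiv.swap m n with hσ
  set U : NL2 H N →L[ℂ] NL2 H N :=
    (Lp.compMeasurePreservingₗᵢ ℂ _ (measurePreserving_comp_perm σ)).toContinuousLinearMap
  have hU : S * T * U = S * T := by
    refine ContinuousLinearMap.ext_prodVec fun h f => ?_
    have hUf : U (prodVec h f) = prodVec h (f ∘ σ.symm) :=
      compMeasurePreserving_perm_prodVec σ h f
    simp only [mul_apply_eq_comp, hUf, hS.comp_prodVec hT hmn]
    have hupd : Function.update (Function.update (f ∘ σ.symm) n a) m a
        = Function.update (Function.update f n a) m a := by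
      ext1 i
      by_cases him : i = m
      · simp [him]
      · by_cases hin : i = n
        · simp [hin, hmn.symm]
        · simp [him, hin, hσ, Equiv.swap_apply_of_ne_of_ne him hin]
    rw [hupd]
    simp [hσ, mul_comm]
  have hUΨ : U Ψ = -Ψ := by
    refine Lp.ext ?_
    filter_upwards [Lp.coeFn_compMeasurePreserving Ψ (measurePreserving_comp_perm σ),
      hΨ σ (by simp), Lp.coeFn_neg Ψ] with x h1 h2 h3
    rw [h3, Pi.neg_apply]
    refine h1.trans (h2.trans ?_)
    simp [hσ, Equiv.Perm.sign_swap hmn]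
  have h := congrArg (fun A : NL2 H N →L[ℂ] NL2 H N => A Ψ) hU
  simp only [mul_apply_eq_comp, hUΨ, map_neg] at h
  have h2 : (2 : ℂ) • S (T Ψ) = 0 := by
    rw [two_smul]
    exact neg_eq_iff_add_eq_zero.1 h
  exact (smul_eq_zero.1 h2).resolve_left two_ne_zero

end ProductVectors

/-- The orthogonal projection onto the span of a finite orthonormal family. -/
theorem Orthonormal.sum_inner_smul_eq_starProjection {E ι : Type*} [NormedAddCommGroup E]
    [InnerProductSpace ℂ E] [Fintype ι] {v : ι → E} (hv : Orthonormal ℂ v) (K : Submodule ℂ E)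
    [K.HasOrthogonalProjection] (hK : Submodule.span ℂ (Set.range v) = K) (x : E) :
    ∑ j, inner ℂ (v j) x • v j = K.starProjection x := by
  subst hK
  refine (Submodule.eq_starProjection_of_mem_orthogonal
    (Submodule.sum_mem _ fun j _ => Submodule.smul_mem _ _
      (Submodule.subset_span (Set.mem_range_self j)))
    ?_).symm
  rw [Submodule.mem_orthogonal]
  intro u hu
  induction hu using Submodule.span_induction with
  | mem u hu =>
    obtain ⟨k, rfl⟩ := hu
    rw [inner_sub_right, hv.inner_right_fintype, sub_self]
  | zero => simp
  | add u w _ _ hu hw => rw [inner_add_left, hu, hw, add_zero]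
  | smul c u _ hu => rw [inner_smul_left, hu, mul_zero]

/-- The sum of the rank-one projections in the `m`-th variable over an orthonormal family depends
only on the span of the family. -/
theorem sum_eq_sum_of_span_eq {H : Type} [NormedAddCommGroup H] [InnerProductSpace ℂ H]
    [CompleteSpace H] {N : ℕ} {ι κ : Type*} [Fintype ι] [Fintype κ] {χ : ι → OneL2} {φ : κ → OneL2}
    (hχ : Orthonormal ℂ χ) (hφ : Orthonormal ℂ φ)
    (hspan : Submodule.span ℂ (Set.range χ) = Submodule.span ℂ (Set.range φ))
    {m : Fin N} {S : ι → NL2 H N →L[ℂ] NL2 H N} {T : κ → NL2 H N →L[ℂ] NL2 H N}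
    (hS : ∀ j, IsRankOneAt (χ j) (χ j) m (S j)) (hT : ∀ j, IsRankOneAt (φ j) (φ j) m (T j)) :
    ∑ j, S j = ∑ j, T j := by
  have : FiniteDimensional ℂ (Submodule.span ℂ (Set.range φ)) :=
    FiniteDimensional.span_of_finite ℂ (Set.finite_range φ)
  refine ContinuousLinearMap.ext_prodVec fun h f => ?_
  simp only [sum_apply, (hS _).apply_prodVec, (hT _).apply_prodVec,
    ← MultilinearMap.map_update_smul, ← MultilinearMap.map_update_sum]
  rw [hχ.sum_inner_smul_eq_starProjection _ hspan, hφ.sum_inner_smul_eq_starProjection _ rfl]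

/-- for orthonormal families `χ` and `φ` with equal spans, the projections
`Q^{χ_j} = 1 - ∑_m p_m^{χ_j}` pairwise commute, `∑_j Q^{χ_j} = ∑_m q_m` (with `q_m` built from
`φ`), and `P^{χ_j}`, `Q^{χ_j}` act idempotently on fully antisymmetric `Ψ`. -/
theorem statement3 (N : ℕ) (χ φ : Fin N → OneL2)
    (hχ : Orthonormal ℂ χ) (hφ : Orthonormal ℂ φ)
    (hspan : Submodule.span ℂ (Set.range χ) = Submodule.span ℂ (Set.range φ))
    (Pχ Pφ : Fin N → Fin N → (NL2 H N →L[ℂ] NL2 H N))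
    (hPχ : ∀ j m : Fin N, IsRankOneAt (χ j) (χ j) m (Pχ j m))
    (hPφ : ∀ j m : Fin N, IsRankOneAt (φ j) (φ j) m (Pφ j m)) :
    (∀ j k : Fin N,
        ((1 : NL2 H N →L[ℂ] NL2 H N) - ∑ m, Pχ j m) * ((1 : NL2 H N →L[ℂ] NL2 H N) - ∑ m, Pχ k m)
          = ((1 : NL2 H N →L[ℂ] NL2 H N) - ∑ m, Pχ k m)
              * ((1 : NL2 H N →L[ℂ] NL2 H N) - ∑ m, Pχ j m)) ∧
    (∑ j, ((1 : NL2 H N →L[ℂ] NL2 H N) - ∑ m, Pχ j m)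
        = ∑ m, ((1 : NL2 H N →L[ℂ] NL2 H N) - ∑ j, Pφ j m)) ∧
    (∀ Ψ : NL2 H N, AntisymmetricOn Finset.univ Ψ → ∀ j : Fin N,
        (∑ m, Pχ j m) ((∑ m, Pχ j m) Ψ) = (∑ m, Pχ j m) Ψ ∧
        ((1 : NL2 H N →L[ℂ] NL2 H N) - ∑ m, Pχ j m)
            (((1 : NL2 H N →L[ℂ] NL2 H N) - ∑ m, Pχ j m) Ψ)
          = ((1 : NL2 H N →L[ℂ] NL2 H N) - ∑ m, Pχ j m) Ψ) := by
  refine ⟨fun j k => ?_, ?_, fun Ψ hΨ j => ?_⟩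
  · rcases eq_or_ne j k with rfl | hjk
    · rfl
    have hcomm : Commute (∑ m, Pχ j m) (∑ m, Pχ k m) := by
      refine Commute.sum_left _ _ _ fun m _ => Commute.sum_right _ _ _ fun n _ => ?_
      rcases eq_or_ne m n with rfl | hmn
      · exact ((hPχ j m).mul_eq_zero_of_inner_eq_zero (hPχ k m) (hχ.2 hjk)).trans
          ((hPχ k m).mul_eq_zero_of_inner_eq_zero (hPχ j m) (hχ.2 hjk.symm)).symm
      · exact (hPχ j m).commute_of_ne (hPχ k n) hmn
    exact ((Commute.one_left _).sub_left
      ((Commute.one_right _).sub_right hcomm)).eq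
  · rw [Finset.sum_sub_distrib, Finset.sum_sub_distrib, Finset.sum_comm]
    exact congrArg _ (Finset.sum_congr rfl fun m _ =>
      sum_eq_sum_of_span_eq hχ hφ hspan (fun j => hPχ j m) fun j => hPφ j m)
  · have hP : (∑ m, Pχ j m) ((∑ m, Pχ j m) Ψ) = (∑ m, Pχ j m) Ψ := by
      simp only [sum_apply, map_sum]
      refine Finset.sum_congr rfl fun m _ => ?_
      rw [Finset.sum_eq_single m
        (fun n _ hn => hΨ.apply_apply_eq_zero (hPχ j n) (hPχ j m) hn)
        (fun hm => absurd (Finset.mem_univ m) hm)]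
      exact congrArg (fun A : NL2 H N →L[ℂ] NL2 H N => A Ψ)
        ((hPχ j m).isIdempotentElem (hχ.1 j))
    refine ⟨hP, ?_⟩
    simp only [sub_apply, one_apply_eq_self, map_sub, hP,
      sub_self, sub_zero]
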